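/- arXiv:1110.3518 — 5 statements merged into one kernel-verified Lean document; each statement's English description precedes it below -/
import Mathlib

section
/- Assume H satisfies the double-well conditions (A1)–(A2) and let X_-, X_+ be the outer inverse branches of H'. For σ ∈ ℝ set H_σ(x) := H(x) − σ·x. Then H_0(X_-(0)) = H_0(X_+(0)), and for every σ with 0 < σ ≤ σ_* the left well has strictly higher effective energy than the right well: H_σ(X_-(σ)) > H_σ(X_+(σ)). In particular, for every σ_b ∈ (0, σ_*] the quantity D_b := (H_{σ_b}(X_-(σ_b)) − H_{σ_b}(X_+(σ_b)))/(X_+(σ_b) − X_-(σ_b)) is strictly positive. -/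
open Set Filter

theorem deriv_neg_of_even {H : ℝ → ℝ} (hEven : ∀ x, H (-x) = H x) (x : ℝ) :
    deriv H (-x) = -deriv H x := by
  have h := deriv_comp_neg H x
  rw [funext hEven] at h
  linarith

/-- If `f'` is strictly increasing on `[a, ∞)` with `a > 0`, then between two points with opposite
slopes `-y` and `y` the increment of `f` is less than `y` times the sum of the points. -/
theorem sub_lt_mul_add_of_strictMonoOn_deriv {f : ℝ → ℝ} (hf : Differentiable ℝ f) {a : ℝ}
    (ha : 0 < a) (hmono : StrictMonoOn (deriv f) (Ici a)) {p m y : ℝ} (hp : a ≤ p) (hm : a ≤ m)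
    (hy : 0 < y) (hfp : deriv f p = y) (hfm : deriv f m = -y) :
    f p - f m < y * (p + m) := by
  have hmp : m < p := (hmono.lt_iff_lt hm hp).1 (by linarith)
  obtain ⟨c, ⟨hmc, hcp⟩, hc⟩ :=
    exists_deriv_eq_slope f hmp hf.continuous.continuousOn hf.differentiableOn
  have hcy : deriv f c < y := hfp ▸ hmono (hm.trans hmc.le) hp hcp
  rw [hc, div_lt_iff₀ (sub_pos.2 hmp)] at hcy
  nlinarith

/-- For the tilted potential `H_σ(x) = H(x) − σx`: at `σ = 0` the two wells have equal
energy, while for `0 < σ ≤ σ_*` the left well `X_-(σ)` has strictly higher effective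
energy than the right well `X_+(σ)`; in particular the dissipation coefficient
`D_b = (H_{σ_b}(X_-(σ_b)) − H_{σ_b}(X_+(σ_b)))/(X_+(σ_b) − X_-(σ_b))` is positive. -/
theorem left_well_higher_energy
    (H : ℝ → ℝ) (hH : ContDiff ℝ 2 H) (hEven : ∀ x, H (-x) = H x)
    (xs xss σs : ℝ) (hxs : 0 < xs) (hxss : xs < xss) (hσs : 0 < σs)
    (hHxs : deriv H xs = -σs) (hHxss : deriv H xss = σs)
    (hmid : ∀ x, 0 < x → x < xs →
      (-σs < deriv H x ∧ deriv H x < 0 ∧ deriv (deriv H) x < 0))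
    (hright : ∀ x, xs < x → 0 < deriv (deriv H) x)
    (htop : Tendsto (deriv H) atTop atTop)
    (Xm Xp : ℝ → ℝ)
    (hXmCont : ContinuousOn Xm (Iic σs)) (hXmMono : StrictMonoOn Xm (Iic σs))
    (hXmMaps : MapsTo Xm (Iic σs) (Iic (-xs)))
    (hXmInv : ∀ y ∈ Iic σs, deriv H (Xm y) = y)
    (hXpCont : ContinuousOn Xp (Ici (-σs))) (hXpMono : StrictMonoOn Xp (Ici (-σs)))
    (hXpMaps : MapsTo Xp (Ici (-σs)) (Ici xs))
    (hXpInv : ∀ y ∈ Ici (-σs), deriv H (Xp y) = y) :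
    H (Xm 0) = H (Xp 0) ∧
    (∀ y : ℝ, 0 < y → y ≤ σs →
      H (Xp y) - y * Xp y < H (Xm y) - y * Xm y) ∧
    (∀ σb : ℝ, 0 < σb → σb ≤ σs →
      0 < ((H (Xm σb) - σb * Xm σb) - (H (Xp σb) - σb * Xp σb)) / (Xp σb - Xm σb)) := by
  have hmono : StrictMonoOn (deriv H) (Ici xs) :=
    strictMonoOn_of_deriv_pos (convex_Ici xs) (hH.continuous_deriv (by norm_num)).continuousOn
      (by rw [interior_Ici]; exact hright)
  have hm : ∀ y ≤ σs, xs ≤ -Xm y := fun y hy => le_neg_of_le_neg (hXmMaps hy)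
  have hdm : ∀ y ≤ σs, deriv H (-Xm y) = -y := fun y hy => by
    rw [deriv_neg_of_even hEven, hXmInv y hy]
  have hp : ∀ y, 0 ≤ y → xs ≤ Xp y ∧ deriv H (Xp y) = y := fun y hy =>
    have hy' : y ∈ Ici (-σs) := by simp only [mem_Ici]; linarith
    ⟨hXpMaps hy', hXpInv y hy'⟩
  have hlt : ∀ y : ℝ, 0 < y → y ≤ σs →
      H (Xp y) - y * Xp y < H (Xm y) - y * Xm y := fun y hy hyσ => by
    have h := sub_lt_mul_add_of_strictMonoOn_deriv (hH.differentiable (by norm_num)) hxs hmono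
      (hp y hy.le).1 (hm y hyσ) hy (hp y hy.le).2 (hdm y hyσ)
    rw [hEven] at h
    linarith
  refine ⟨?_, hlt, fun y hy hyσ => div_pos (sub_pos.2 (hlt y hy hyσ)) ?_⟩
  · have h : -Xm 0 = Xp 0 := hmono.injOn (hm 0 hσs.le) (hp 0 le_rfl).1 (by
      rw [hdm 0 hσs.le, (hp 0 le_rfl).2, neg_zero])
    rw [← h, hEven]
  · linarith [hm y hyσ, (hp y hy.le).1]
end

section
/- Let τ > 0, let m₁, m₂ > 0 with m₁ + m₂ = 1, let A₁, A₂, g₁, g₂ : I → ℝ be continuous functions on an interval I with m₁·g₁(t) + m₂·g₂(t) = 0 for all t, and let y₁, y₂ : I → ℝ be differentiable solutions of the linearized two-peaks system τ·y₁'(t) = m₂·(A₂(t)·y₂(t) − A₁(t)·y₁(t)) + g₁(t) and τ·y₂'(t) = m₁·(A₁(t)·y₁(t) − A₂(t)·y₂(t)) + g₂(t), with m₁·y₁(t₀) + m₂·y₂(t₀) = 0 for some t₀ ∈ I. Then m₁·y₁(t) + m₂·y₂(t) = 0 for all t ∈ I, and the system decouples: τ·yᵢ'(t) = −ζ(t)·yᵢ(t)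 + gᵢ(t) for i = 1, 2, where ζ(t) := m₁·A₂(t) + m₂·A₁(t). -/
open Set

/-- The linearized two-peaks system `τ ẏ₁ = m₂(A₂ y₂ − A₁ y₁) + g₁`,
`τ ẏ₂ = m₁(A₁ y₁ − A₂ y₂) + g₂` with `m₁ g₁ + m₂ g₂ = 0` preserves the constraint
`m₁ y₁ + m₂ y₂ = 0` and decouples into `τ ẏᵢ = −ζ yᵢ + gᵢ` with
`ζ = m₁ A₂ + m₂ A₁`. -/
theorem linearized_two_peaks_decoupling
    (τ : ℝ) (hτ : 0 < τ)
    (m1 m2 : ℝ) (hm1 : 0 < m1) (hm2 : 0 < m2) (hsum : m1 + m2 = 1)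
    (I : Set ℝ) (hI : Convex ℝ I)
    (A1 A2 g1 g2 : ℝ → ℝ)
    (hA1 : ContinuousOn A1 I) (hA2 : ContinuousOn A2 I)
    (hg1 : ContinuousOn g1 I) (hg2 : ContinuousOn g2 I)
    (hg : ∀ t ∈ I, m1 * g1 t + m2 * g2 t = 0)
    (y1 y2 : ℝ → ℝ)
    (hy1 : ∀ t ∈ I, DifferentiableAt ℝ y1 t ∧
      τ * deriv y1 t = m2 * (A2 t * y2 t - A1 t * y1 t) + g1 t)
    (hy2 : ∀ t ∈ I, DifferentiableAt ℝ y2 t ∧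
      τ * deriv y2 t = m1 * (A1 t * y1 t - A2 t * y2 t) + g2 t)
    (t0 : ℝ) (ht0 : t0 ∈ I) (hinit : m1 * y1 t0 + m2 * y2 t0 = 0) :
    (∀ t ∈ I, m1 * y1 t + m2 * y2 t = 0) ∧
    (∀ t ∈ I,
      τ * deriv y1 t = -(m1 * A2 t + m2 * A1 t) * y1 t + g1 t ∧
      τ * deriv y2 t = -(m1 * A2 t + m2 * A1 t) * y2 t + g2 t) := by
  have hderiv : ∀ t ∈ I,
      HasDerivWithinAt (fun s => m1 * y1 s + m2 * y2 s) 0 I t := by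
    intro t ht
    obtain ⟨hd1, he1⟩ := hy1 t ht
    obtain ⟨hd2, he2⟩ := hy2 t ht
    have hzero : m1 * deriv y1 t + m2 * deriv y2 t = 0 := by
      refine (mul_eq_zero.mp ?_).resolve_left hτ.ne'
      linear_combination m1 * he1 + m2 * he2 + hg t ht
    rw [← hzero]
    exact ((hd1.hasDerivAt.const_mul m1).add (hd2.hasDerivAt.const_mul m2)).hasDerivWithinAt
  have hconstraint : ∀ t ∈ I, m1 * y1 t + m2 * y2 t = 0 := by
    intro t ht
    have hbound := hI.norm_image_sub_le_of_norm_hasDerivWithin_le hderiv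
      (fun _ _ => norm_zero.le) ht0 ht
    rw [zero_mul, norm_le_zero_iff, sub_eq_zero] at hbound
    exact hbound.trans hinit
  refine ⟨hconstraint, fun t ht => ⟨?_, ?_⟩⟩
  · linear_combination (hy1 t ht).2 + A2 t * hconstraint t ht
  · linear_combination (hy2 t ht).2 + A1 t * hconstraint t ht
end

section
/- Let H : ℝ → ℝ be twice continuously differentiable, let m₁, m₂ ≥ 0 with m₁ + m₂ = 1, and let x₁, x₂, σ, ℓ : I → ℝ be differentiable functions on an interval I satisfying the quasi-stationary constraints H'(x₁(t)) = H'(x₂(t)) = σ(t) and m₁·x₁(t) + m₂·x₂(t) = ℓ(t) for all t ∈ I. Fix t ∈ I and set Z := m₁·H''(x₂(t)) + m₂·H''(x₁(t)). If H''(x₂(t)) ≠ 0 and Z ≠ 0, then x₁'(t) = H''(x₂(t))·ℓ'(t)/Z, x₂'(t) = H''(x₁(t))·ℓ'(t)/Z, and σ'(t) = H''(x₁(t))·H''(x₂(t))·ℓ'(t)/Z. Moreover, without any nondegeneracy assumption, the energy E(t) := m₁·H(x₁(t)) + m₂·H(x₂(t)) satisfies E'(t) = σ(t)·ℓ'(t).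 -/
open Set

/-- For a quasi-stationary two-peaks configuration, `H'(x₁) = H'(x₂) = σ` and
`m₁x₁ + m₂x₂ = ℓ` imply `ẋ₁ = H''(x₂)ℓ'/Z`, `ẋ₂ = H''(x₁)ℓ'/Z` and
`σ' = H''(x₁)H''(x₂)ℓ'/Z` with `Z = m₁H''(x₂) + m₂H''(x₁)` (whenever `H''(x₂) ≠ 0`
and `Z ≠ 0`); moreover the energy `E = m₁H(x₁) + m₂H(x₂)` always satisfies
`E' = σ ℓ'`. -/
theorem quasi_stationary_two_peaks_ode
    (H : ℝ → ℝ) (hH : ContDiff ℝ 2 H)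
    (m1 m2 : ℝ) (hm1 : 0 ≤ m1) (hm2 : 0 ≤ m2) (hsum : m1 + m2 = 1)
    (I : Set ℝ) (hI : IsOpen I)
    (x1 x2 σ ℓ : ℝ → ℝ)
    (hdiff : ∀ t ∈ I, DifferentiableAt ℝ x1 t ∧ DifferentiableAt ℝ x2 t ∧
      DifferentiableAt ℝ σ t ∧ DifferentiableAt ℝ ℓ t)
    (hcon : ∀ t ∈ I, deriv H (x1 t) = σ t ∧ deriv H (x2 t) = σ t ∧
      m1 * x1 t + m2 * x2 t = ℓ t)
    (t : ℝ) (ht : t ∈ I) :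
    ((deriv (deriv H) (x2 t) ≠ 0 →
      m1 * deriv (deriv H) (x2 t) + m2 * deriv (deriv H) (x1 t) ≠ 0 →
      deriv x1 t = deriv (deriv H) (x2 t) * deriv ℓ t /
        (m1 * deriv (deriv H) (x2 t) + m2 * deriv (deriv H) (x1 t)) ∧
      deriv x2 t = deriv (deriv H) (x1 t) * deriv ℓ t /
        (m1 * deriv (deriv H) (x2 t) + m2 * deriv (deriv H) (x1 t)) ∧
      deriv σ t = deriv (deriv H) (x1 t) * deriv (deriv H) (x2 t) * deriv ℓ t /
        (m1 * deriv (deriv H) (x2 t) + m2 * deriv (deriv H) (x1 t)))) ∧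
    HasDerivAt (fun s => m1 * H (x1 s) + m2 * H (x2 s)) (σ t * deriv ℓ t) t := by
  obtain ⟨d1, d2, -, -⟩ := hdiff t ht
  obtain ⟨c1, c2, -⟩ := hcon t ht
  have hI_nhds : ∀ᶠ s in nhds t, s ∈ I := hI.mem_nhds ht
  have hH' : Differentiable ℝ (deriv H) :=
    (hH.iterate_deriv' 1 1).differentiable one_ne_zero
  have hH0 : Differentiable ℝ H := hH.differentiable two_ne_zero
  have hσ1 : deriv σ t = deriv (deriv H) (x1 t) * deriv x1 t := by
    refine (((hH' (x1 t)).hasDerivAt.comp t d1.hasDerivAt).congr_of_eventuallyEq ?_).deriv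
    filter_upwards [hI_nhds] with s hs using (hcon s hs).1.symm
  have hσ2 : deriv σ t = deriv (deriv H) (x2 t) * deriv x2 t := by
    refine (((hH' (x2 t)).hasDerivAt.comp t d2.hasDerivAt).congr_of_eventuallyEq ?_).deriv
    filter_upwards [hI_nhds] with s hs using (hcon s hs).2.1.symm
  have hℓ : deriv ℓ t = m1 * deriv x1 t + m2 * deriv x2 t := by
    refine (((d1.hasDerivAt.const_mul m1).add
      (d2.hasDerivAt.const_mul m2)).congr_of_eventuallyEq ?_).deriv
    filter_upwards [hI_nhds] with s hs using (hcon s hs).2.2.symm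
  refine ⟨fun _ hZ => ⟨?_, ?_, ?_⟩, ?_⟩
  · rw [eq_div_iff hZ, hℓ]
    linear_combination m2 * (hσ2 - hσ1)
  · rw [eq_div_iff hZ, hℓ]
    linear_combination m1 * (hσ1 - hσ2)
  · rw [eq_div_iff hZ, hℓ]
    linear_combination
      m1 * deriv (deriv H) (x2 t) * hσ1 + m2 * deriv (deriv H) (x1 t) * hσ2
  · have h1 := (hH0 (x1 t)).hasDerivAt.comp t d1.hasDerivAt
    have h2 := (hH0 (x2 t)).hasDerivAt.comp t d2.hasDerivAt
    refine ((h1.const_mul m1).add (h2.const_mul m2)).congr_deriv ?_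
    rw [c1, c2, hℓ]
    ring
end

section
/- Let τ, ν > 0 and let H : ℝ → ℝ be twice continuously differentiable. Let σ : I → ℝ be continuous and let x₁, λ, θ : I → ℝ be continuously differentiable with λ(t) > 0, satisfying τ·x₁'(t) = σ(t) − H'(x₁(t)), τ·λ'(t) = −H''(x₁(t))·λ(t), and τ·θ'(t) = λ(t)⁻². Let R = R(y, θ) be a solution of the heat equation ∂_θ R = ∂_y² R, twice continuously differentiable in y and once in θ, on a domain containing ℝ × θ(I). Define ρ(x, t) := (ν·λ(t))⁻¹ · R((x − x₁(t))/(ν·λ(t)), θ(t)). Then ρ solves the linearized Fokker–Planck equation τ·∂ₜρ(x,t) = ∂ₓ( ν²·∂ₓρ(x,t) + (H'(x₁(t)) + H''(x₁(t))·(x − x₁(t)) − σ(t))·ρ(x,t) ) on ℝ × I. -/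
/-- Chain rule for a jointly differentiable function of two real variables along a curve, in terms
of its partial derivatives. -/
theorem hasDerivAt_comp_curve_of_partial {R : ℝ → ℝ → ℝ} {u v : ℝ → ℝ} {t u' v' a b : ℝ}
    (hR : DifferentiableAt ℝ (fun p : ℝ × ℝ => R p.1 p.2) (u t, v t))
    (ha : HasDerivAt (fun y => R y (v t)) a (u t)) (hb : HasDerivAt (R (u t)) b (v t))
    (hu : HasDerivAt u u' t) (hv : HasDerivAt v v' t) :
    HasDerivAt (fun s => R (u s) (v s)) (a * u' + b * v') t := by
  obtain ⟨F, hF⟩ := hR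
  have h1 : F (1, 0) = a := HasDerivAt.unique
    (HasFDerivAt.comp_hasDerivAt (f := fun y => (y, v t)) (u t) hF
      ((hasDerivAt_id (u t)).prodMk (hasDerivAt_const (u t) (v t)))) ha
  have h2 : F (0, 1) = b := HasDerivAt.unique
    (HasFDerivAt.comp_hasDerivAt (f := fun z => (u t, z)) (v t) hF
      ((hasDerivAt_const (v t) (u t)).prodMk (hasDerivAt_id (v t)))) hb
  have h3 : F (u', v') = a * u' + b * v' := by
    have : (u', v') = u' • ((1 : ℝ), (0 : ℝ)) + v' • ((0 : ℝ), (1 : ℝ)) := by simp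
    rw [this, map_add, map_smul, map_smul, h1, h2, smul_eq_mul, smul_eq_mul]
    ring
  rw [← h3]
  exact hF.comp_hasDerivAt t (hu.prodMk hv)

/-- The derivative of `x ↦ f ((x - a) / L)`. -/
theorem HasDerivAt.comp_sub_div {f : ℝ → ℝ} {f' x : ℝ} (a L : ℝ)
    (hf : HasDerivAt f f' ((x - a) / L)) :
    HasDerivAt (fun z => f ((z - a) / L)) (f' * L⁻¹) x := by
  have h : HasDerivAt (fun z : ℝ => (z - a) / L) (1 / L) x :=
    ((hasDerivAt_id x).sub_const a).div_const L
  rw [← one_div]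
  exact hf.comp x h

/-- If `R` solves the heat equation `∂_θ R = ∂_y² R` and `x₁, λ, θ` solve
`τ ẋ₁ = σ − H'(x₁)`, `τ λ̇ = −H''(x₁) λ`, `τ θ̇ = λ⁻²`, then the rescaled profile
`ρ(x,t) = (νλ(t))⁻¹ R((x − x₁(t))/(νλ(t)), θ(t))` solves the linearized
Fokker–Planck equation
`τ ∂ₜρ = ∂ₓ(ν² ∂ₓρ + (H'(x₁) + H''(x₁)(x − x₁) − σ) ρ)`. -/
theorem peak_widening_rescaling
    (τ ν : ℝ) (hτ : 0 < τ) (hν : 0 < ν)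
    (H : ℝ → ℝ) (hH : ContDiff ℝ 2 H)
    (I : Set ℝ) (σ : ℝ → ℝ) (hσ : ContinuousOn σ I)
    (x1 lam θ : ℝ → ℝ) (hlam_pos : ∀ t, 0 < lam t)
    (hx1 : ∀ t ∈ I, HasDerivAt x1 ((σ t - deriv H (x1 t)) / τ) t)
    (hlam : ∀ t ∈ I, HasDerivAt lam (-(deriv (deriv H) (x1 t)) * lam t / τ) t)
    (hθ : ∀ t ∈ I, HasDerivAt θ (((lam t) ^ 2)⁻¹ / τ) t)
    (R : ℝ → ℝ → ℝ)
    (hR1 : ContDiff ℝ 1 (fun p : ℝ × ℝ => R p.1 p.2))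
    (hR2 : ∀ ϑ : ℝ, ContDiff ℝ 2 (fun y => R y ϑ))
    (hheat : ∀ y : ℝ, ∀ t ∈ I,
      HasDerivAt (fun ϑ => R y ϑ) (deriv (deriv (fun y' => R y' (θ t))) y) (θ t))
    (ρ : ℝ → ℝ → ℝ)
    (hρ : ∀ x t, ρ x t = (ν * lam t)⁻¹ * R ((x - x1 t) / (ν * lam t)) (θ t)) :
    ∀ x : ℝ, ∀ t ∈ I,
      τ * deriv (fun s => ρ x s) t =
        deriv (fun x' => ν ^ 2 * deriv (fun x'' => ρ x'' t) x' +
          (deriv H (x1 t) + deriv (deriv H) (x1 t) * (x' - x1 t) - σ t) * ρ x' t) x := by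
  intro x t ht
  have hl : lam t ≠ 0 := (hlam_pos t).ne'
  have hν' : ν ≠ 0 := hν.ne'
  have hτ' : τ ≠ 0 := hτ.ne'
  have hL : ν * lam t ≠ 0 := mul_ne_zero hν' hl
  have hRy (y : ℝ) : HasDerivAt (fun y' => R y' (θ t)) (deriv (fun y' => R y' (θ t)) y) y :=
    ((hR2 (θ t)).differentiable (by norm_num) y).hasDerivAt
  have hRyy (y : ℝ) : HasDerivAt (deriv fun y' => R y' (θ t))
      (deriv (deriv fun y' => R y' (θ t)) y) y :=
    ((ContDiff.deriv' (n := 1) (hR2 (θ t))).differentiable (by norm_num) y).hasDerivAt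
  have hρx (z : ℝ) : HasDerivAt (fun z' => ρ z' t)
      ((ν * lam t)⁻¹ *
        (deriv (fun y' => R y' (θ t)) ((z - x1 t) / (ν * lam t)) * (ν * lam t)⁻¹)) z := by
    simp only [hρ]
    exact ((hRy _).comp_sub_div (x1 t) (ν * lam t)).const_mul _
  have hρx' := funext fun z => (hρx z).deriv
  have hdrift : HasDerivAt
      (fun z => deriv H (x1 t) + deriv (deriv H) (x1 t) * (z - x1 t) - σ t)
      (deriv (deriv H) (x1 t) * 1) x :=
    ((((hasDerivAt_id x).sub_const (x1 t)).const_mul _).const_add _).sub_const _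
  have hflux := (((((hRyy _).comp_sub_div (x := x) (x1 t) (ν * lam t)).mul_const
    (ν * lam t)⁻¹).const_mul (ν * lam t)⁻¹).const_mul (ν ^ 2)).add (hdrift.mul (hρx x))
  have hscale := (hlam t ht).const_mul ν
  have hρt := (hscale.fun_inv hL).fun_mul (hasDerivAt_comp_curve_of_partial
    (u := fun s => (x - x1 s) / (ν * lam s)) (hR1.differentiable (by norm_num) _) (hRy _)
    (hheat _ t ht) (((hx1 t ht).const_sub x).fun_div hscale hL) (hθ t ht))
  rw [funext (hρ x), hρt.deriv]
  simp only [hρx']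
  refine Eq.trans ?_ hflux.deriv.symm
  rw [hρ x t]
  field_simp
  ring
end

section
/- Let a ∈ ℝ, δ > 0, t₀ < t, and let φ : [t₀, t] → ℝ be continuous with φ(s) ≤ 0 for all s ∈ [t₀, t], φ(t₁) = 0 for some t₁ ∈ [t₀, t), and φ(t) + a = −δ. For τ > 0 define w(τ)² := (1/τ)·exp(−(2/τ)·(φ(t) + a))·∫_{t₀}^{t} exp((2/τ)·φ(s)) ds. Then lim_{τ→0⁺} τ·log( w(τ)² ) = 2δ; in particular w(τ)² → ∞ as τ → 0⁺, i.e. the width of the unstable peak blows up once φ drops below −a. -/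
open MeasureTheory Set Filter

/-- Laplace's principle on an interval: `r⁻¹ log ∫ exp (r φ)` tends to the maximum of `φ`
as `r → ∞`. -/
theorem tendsto_log_integral_exp_mul_div {φ : ℝ → ℝ} {x y c : ℝ}
    (hφ : ContinuousOn φ (Icc x y)) (hc : c ∈ Ico x y) (hmax : IsMaxOn φ (Icc x y) c) :
    Tendsto (fun r => Real.log (∫ s in x..y, Real.exp (r * φ s)) / r) atTop (nhds (φ c)) := by
  have hxy : x < y := hc.1.trans_lt hc.2
  have hcont (r : ℝ) : ContinuousOn (fun s => Real.exp (r * φ s)) (Icc x y) := by fun_prop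
  have hint (r : ℝ) {u v : ℝ} (hu : u ∈ Icc x y) (hv : v ∈ Icc x y) :
      IntervalIntegrable (fun s => Real.exp (r * φ s)) volume u v :=
    ((hcont r).mono (uIcc_subset_Icc hu hv)).intervalIntegrable
  have hlim (l m : ℝ) : Tendsto (fun r : ℝ => l / r + m) atTop (nhds m) := by
    simpa using (tendsto_const_nhds (x := l)).div_atTop tendsto_id |>.add_const m
  have hpos (r : ℝ) : 0 < ∫ s in x..y, Real.exp (r * φ s) :=
    intervalIntegral.intervalIntegral_pos_of_pos
      (hint r (left_mem_Icc.2 hxy.le) (right_mem_Icc.2 hxy.le)) (fun _ => Real.exp_pos _) hxy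
  refine tendsto_order.2 ⟨fun l hl => ?_, fun u hu => ?_⟩
  · obtain ⟨m, hlm, hmc⟩ := exists_between hl
    have hnear : ∀ᶠ s in nhdsWithin c (Ici c), m < φ s := by
      have h := (hφ c (Ico_subset_Icc_self hc)).eventually_const_lt hmc
      rw [← nhdsWithin_Icc_eq_nhdsGE hc.2]
      exact h.filter_mono (nhdsWithin_mono _ (Icc_subset_Icc_left hc.1))
    obtain ⟨d, ⟨hcd, hdy⟩, hd⟩ := (mem_nhdsGE_iff_exists_mem_Ioc_Ico_subset hc.2).1 hnear
    have hdmem : d ∈ Icc x y := ⟨hc.1.trans hcd.le, hdy⟩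
    filter_upwards [(hlim (Real.log (d - c)) m).eventually_const_lt hlm, eventually_gt_atTop 0]
      with r hr hr0
    refine hr.trans_le ?_
    have hle : (d - c) * Real.exp (r * m) ≤ ∫ s in x..y, Real.exp (r * φ s) := calc
      (d - c) * Real.exp (r * m) = ∫ _ in c..d, Real.exp (r * m) := by simp
      _ ≤ ∫ s in c..d, Real.exp (r * φ s) := by
        refine intervalIntegral.integral_mono_on_of_le_Ioo hcd.le (by simp)
          (hint r (Ico_subset_Icc_self hc) hdmem) fun s hs => ?_
        have : m < φ s := hd (Ioo_subset_Ico_self hs)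
        gcongr
      _ ≤ ∫ s in x..y, Real.exp (r * φ s) :=
        intervalIntegral.integral_mono_interval hc.1 hcd.le hdy
          (Eventually.of_forall fun _ => (Real.exp_pos _).le)
          (hint r (left_mem_Icc.2 hxy.le) (right_mem_Icc.2 hxy.le))
    have hdc : 0 < d - c := sub_pos.2 hcd
    have hlog := Real.log_le_log (by positivity) hle
    rw [Real.log_mul hdc.ne' (Real.exp_pos _).ne', Real.log_exp] at hlog
    rw [le_div_iff₀ hr0, add_mul, div_mul_cancel₀ _ hr0.ne']
    linarith
  · filter_upwards [(hlim (Real.log (y - x)) (φ c)).eventually_lt_const hu,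
      eventually_gt_atTop 0] with r hr hr0
    refine lt_of_le_of_lt ?_ hr
    have hle : ∫ s in x..y, Real.exp (r * φ s) ≤ (y - x) * Real.exp (r * φ c) := calc
      ∫ s in x..y, Real.exp (r * φ s) ≤ ∫ _ in x..y, Real.exp (r * φ c) := by
        refine intervalIntegral.integral_mono_on hxy.le
          (hint r (left_mem_Icc.2 hxy.le) (right_mem_Icc.2 hxy.le)) (by simp) fun s hs => ?_
        have : φ s ≤ φ c := hmax hs
        gcongr
      _ = (y - x) * Real.exp (r * φ c) := by simp
    have hlog := Real.log_le_log (hpos r) hle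
    rw [Real.log_mul (sub_pos.2 hxy).ne' (Real.exp_pos _).ne', Real.log_exp] at hlog
    rw [div_le_iff₀ hr0, add_mul, div_mul_cancel₀ _ hr0.ne']
    linarith

/-- Once `φ(t) + a = −δ < 0`, the squared width
`w(τ)² = (1/τ) exp(−(2/τ)(φ(t)+a)) ∫ₜ₀ᵗ exp((2/τ)φ(s)) ds` satisfies
`τ log w(τ)² → 2δ` as `τ → 0⁺`; in particular `w(τ)² → ∞`, i.e. the width of the
unstable peak blows up once `φ` drops below `−a`. -/
theorem peak_width_blow_up
    (a δ t0 t t1 : ℝ) (hδ : 0 < δ) (ht0t : t0 < t)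
    (φ : ℝ → ℝ) (hφc : ContinuousOn φ (Icc t0 t))
    (hφnonpos : ∀ s ∈ Icc t0 t, φ s ≤ 0)
    (ht1 : t1 ∈ Ico t0 t) (hφt1 : φ t1 = 0)
    (hφt : φ t + a = -δ)
    (wsq : ℝ → ℝ)
    (hw : ∀ τ : ℝ, 0 < τ → wsq τ =
      (1 / τ) * Real.exp (-(2 / τ) * (φ t + a)) * ∫ s in t0..t, Real.exp ((2 / τ) * φ s)) :
    Tendsto (fun τ => τ * Real.log (wsq τ)) (nhdsWithin 0 (Ioi 0)) (nhds (2 * δ)) ∧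
    Tendsto wsq (nhdsWithin 0 (Ioi 0)) atTop := by
  have hcont (r : ℝ) : ContinuousOn (fun s => Real.exp (r * φ s)) (uIcc t0 t) := by
    rw [uIcc_of_le ht0t.le]; fun_prop
  have hIpos (r : ℝ) : 0 < ∫ s in t0..t, Real.exp (r * φ s) :=
    intervalIntegral.intervalIntegral_pos_of_pos (hcont r).intervalIntegrable
      (fun _ => Real.exp_pos _) ht0t
  have hinv : Tendsto (fun τ : ℝ => 2 / τ) (nhdsWithin 0 (Ioi 0)) atTop := by
    simpa [div_eq_mul_inv] using tendsto_inv_nhdsGT_zero.const_mul_atTop (two_pos (α := ℝ))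
  have hLaplace := (tendsto_log_integral_exp_mul_div hφc ht1
    (fun s hs => (hφnonpos s hs).trans_eq hφt1.symm)).comp hinv
  rw [hφt1] at hLaplace
  have hlog0 : Tendsto (fun τ : ℝ => Real.log τ * τ) (nhdsWithin 0 (Ioi 0)) (nhds 0) := by
    simpa using tendsto_log_mul_rpow_nhdsGT_zero one_pos
  have hrate : Tendsto (fun τ => τ * Real.log (wsq τ)) (nhdsWithin 0 (Ioi 0))
      (nhds (2 * δ)) := by
    have h := (hlog0.neg.add_const (2 * δ)).add (hLaplace.const_mul 2)
    rw [neg_zero, zero_add, mul_zero, add_zero] at h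
    refine h.congr' ?_
    filter_upwards [self_mem_nhdsWithin] with τ (hτ : 0 < τ)
    rw [hw τ hτ, Real.log_mul (by positivity) (hIpos _).ne',
      Real.log_mul (by positivity) (Real.exp_pos _).ne', Real.log_exp, hφt, one_div,
      Real.log_inv, Function.comp_apply]
    field_simp
  refine ⟨hrate, ?_⟩
  have hlog := hrate.pos_mul_atTop (by positivity) tendsto_inv_nhdsGT_zero
  refine (Real.tendsto_exp_atTop.comp hlog).congr' ?_
  filter_upwards [self_mem_nhdsWithin] with τ (hτ : 0 < τ)
  have hwpos : 0 < wsq τ := by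
    rw [hw τ hτ]
    have := hIpos (2 / τ)
    positivity
  rw [Function.comp_apply, mul_right_comm, mul_inv_cancel₀ hτ.ne', one_mul, Real.exp_log hwpos]
end
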